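/- Let B = {b_1,...,b_n} be a strongly reduced basis of a lattice Λ with successive minima λ_1 ≤ ... ≤ λ_n. Then for all 1 ≤ i ≤ n, ‖b_i‖² ≤ max{1, (i−k_i)/4 + k_i/16} · λ_i², where k_i is the number of indices j ∈ {1,...,i−1} with ‖b_j‖ > λ_j. -/

import Mathlib

open Finset
open scoped RealInnerProductSpace

noncomputable def latticeOf {n : ℕ} (b : Fin n → EuclideanSpace ℝ (Fin n)) :
    AddSubgroup (EuclideanSpace ℝ (Fin n)) := AddSubgroup.closure (Set.range b)

/-- The `i`-th successive minimum of a lattice `L` (with `i ≥ 1`): the least `r ≥ 0`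
such that the closed ball of radius `r` contains `i` linearly independent lattice vectors. -/
noncomputable def succMin {n : ℕ} (L : AddSubgroup (EuclideanSpace ℝ (Fin n))) (i : ℕ) : ℝ :=
  sInf {r : ℝ | 0 ≤ r ∧ ∃ v : Fin i → EuclideanSpace ℝ (Fin n),
    (∀ j, v j ∈ L) ∧ LinearIndependent ℝ v ∧ ∀ j, ‖v j‖ ≤ r}

/-- A basis `b` of the full-rank lattice it generates is *strongly reduced* if
(1) there are linearly independent lattice vectors `v i` realizing the successive minima whose
integer coordinates over `b` have nonzero `i`-th coordinate and vanish beyond `i`, and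
(2) each `b i` is shortest in its coset modulo the preceding basis vectors. -/
def StronglyReduced {n : ℕ} (b : Fin n → EuclideanSpace ℝ (Fin n)) : Prop :=
  (∃ v : Fin n → EuclideanSpace ℝ (Fin n), ∃ x : Fin n → Fin n → ℤ,
    LinearIndependent ℝ v ∧ (∀ i, v i ∈ latticeOf b) ∧
    (∀ i : Fin n, ‖v i‖ = succMin (latticeOf b) ((i : ℕ) + 1)) ∧
    (∀ i, v i = ∑ j, x i j • b j) ∧
    (∀ i, x i i ≠ 0) ∧ (∀ i j, i < j → x i j = 0)) ∧
  (∀ i : Fin n, ∀ c : Fin n → ℤ,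
    ‖b i‖ ≤ ‖b i + ∑ j ∈ Finset.univ.filter (· < i), c j • b j‖)

open InnerProductSpace in
lemma sr_sub_mem {n : ℕ} (b : Fin n → EuclideanSpace ℝ (Fin n)) (i : Fin n) :
    b i - gramSchmidt ℝ b i ∈ Submodule.span ℝ (b '' Set.Iio i) := by
  rw [gramSchmidt_def, sub_sub_cancel, ← span_gramSchmidt_Iio ℝ b i]
  refine Submodule.sum_mem _ fun j hj => ?_
  have h1 : Submodule.span ℝ {gramSchmidt ℝ b j} ≤
      Submodule.span ℝ (gramSchmidt ℝ b '' Set.Iio i) := by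
    apply Submodule.span_mono
    rintro _ rfl
    exact ⟨j, by simpa using hj, rfl⟩
  apply h1
  exact Submodule.starProjection_apply_mem _ _

open InnerProductSpace in
lemma sr_inner_zero {n : ℕ} (b : Fin n → EuclideanSpace ℝ (Fin n)) (i : Fin n)
    (u : EuclideanSpace ℝ (Fin n)) (hu : u ∈ Submodule.span ℝ (b '' Set.Iio i)) :
    inner ℝ (gramSchmidt ℝ b i) u = 0 := by
  induction hu using Submodule.span_induction with
  | mem x h =>
    obtain ⟨j, hj, rfl⟩ := h
    exact gramSchmidt_inv_triangular ℝ b hj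
  | zero => simp
  | add x y _ _ hx hy => rw [inner_add_right, hx, hy, add_zero]
  | smul a x _ hx => rw [inner_smul_right, hx, mul_zero]

open InnerProductSpace in
lemma sr_pyth {n : ℕ} (b : Fin n → EuclideanSpace ℝ (Fin n)) (i : Fin n)
    (u : EuclideanSpace ℝ (Fin n)) (hu : u ∈ Submodule.span ℝ (b '' Set.Iio i)) (t : ℝ) :
    ‖t • gramSchmidt ℝ b i + u‖ ^ 2 = t ^ 2 * ‖gramSchmidt ℝ b i‖ ^ 2 + ‖u‖ ^ 2 := by
  rw [norm_add_sq_real, inner_smul_left, sr_inner_zero b i u hu, norm_smul, mul_pow]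
  simp

lemma sr_filter_succ {n : ℕ} (m : ℕ) (hm : m < n) :
    Finset.univ.filter (fun j : Fin n => (j : ℕ) < m + 1) =
      insert ⟨m, hm⟩ (Finset.univ.filter (fun j : Fin n => (j : ℕ) < m)) := by
  ext j
  simp only [Finset.mem_filter, Finset.mem_univ, true_and, Finset.mem_insert, Fin.ext_iff]
  omega

lemma sr_set_eq {n : ℕ} (m : ℕ) (hm : m < n) :
    {j : Fin n | (j : ℕ) < m} = Set.Iio ⟨m, hm⟩ := by
  ext j
  simp [Fin.lt_def]

open InnerProductSpace in
lemma sr_babai {n : ℕ} (b : Fin n → EuclideanSpace ℝ (Fin n)) (m : ℕ) (hm : m ≤ n) :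
    ∀ u ∈ Submodule.span ℝ (b '' {j : Fin n | (j : ℕ) < m}), ∃ c : Fin n → ℤ,
      ‖u + ∑ j ∈ Finset.univ.filter (fun j : Fin n => (j : ℕ) < m), c j • b j‖ ^ 2 ≤
        ∑ j ∈ Finset.univ.filter (fun j : Fin n => (j : ℕ) < m),
          ‖gramSchmidt ℝ b j‖ ^ 2 / 4 := by
  induction m with
  | zero =>
    intro u hu
    refine ⟨0, ?_⟩
    have : u = 0 := by simpa using hu
    simp [this]
  | succ m ih =>
    intro u hu
    have hmn : m < n := hm
    have hset : {j : Fin n | (j : ℕ) < m + 1} = insert ⟨m, hmn⟩ {j : Fin n | (j : ℕ) < m} := by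
      ext j
      simp only [Set.mem_ofPred_eq, Set.mem_insert_iff, Fin.ext_iff]
      omega
    rw [hset, Set.image_insert_eq, Submodule.mem_span_insert] at hu
    obtain ⟨t, u', hu', rfl⟩ := hu
    set p : Fin n := ⟨m, hmn⟩ with hp
    have hsub := sr_sub_mem b p
    rw [← sr_set_eq m hmn] at hsub
    have hu'' : u' + (t - round t) • (b p - gramSchmidt ℝ b p) ∈
        Submodule.span ℝ (b '' {j : Fin n | (j : ℕ) < m}) :=
      Submodule.add_mem _ hu' (Submodule.smul_mem _ _ hsub)
    obtain ⟨c, hc⟩ := ih hmn.le _ hu''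
    have hnot : p ∉ Finset.univ.filter (fun j : Fin n => (j : ℕ) < m) := by simp [hp]
    refine ⟨fun j => if j = p then - round t else c j, ?_⟩
    rw [sr_filter_succ m hmn, Finset.sum_insert hnot, Finset.sum_insert hnot]
    have hcong : ∑ j ∈ Finset.univ.filter (fun j : Fin n => (j : ℕ) < m),
        (if j = p then - round t else c j) • b j =
        ∑ j ∈ Finset.univ.filter (fun j : Fin n => (j : ℕ) < m), c j • b j := by
      refine Finset.sum_congr rfl fun j hj => ?_
      rw [if_neg]
      rintro rfl
      exact hnot hj
    rw [hcong]
    set s := ∑ j ∈ Finset.univ.filter (fun j : Fin n => (j : ℕ) < m), c j • b j with hs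
    have hsmem : s ∈ Submodule.span ℝ (b '' {j : Fin n | (j : ℕ) < m}) := by
      refine Submodule.sum_mem _ fun j hj => ?_
      rw [← Int.cast_smul_eq_zsmul ℝ]
      exact Submodule.smul_mem _ _ (Submodule.subset_span ⟨j, by simpa using hj, rfl⟩)
    have hmem := Submodule.add_mem _ hu'' hsmem
    rw [sr_set_eq m hmn] at hmem
    have hpy := sr_pyth b p _ hmem (t - round t)
    have heq : t • b p + u' + ((if p = p then - round t else c p) • b p + s) =
        (t - round t) • gramSchmidt ℝ b p +
          (u' + (t - round t) • (b p - gramSchmidt ℝ b p) + s) := by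
      rw [if_pos rfl, ← Int.cast_smul_eq_zsmul ℝ]
      push_cast
      module
    have hr : (t - round t) ^ 2 ≤ 1 / 4 := by
      have := abs_le.mp (abs_sub_round t)
      nlinarith [this.1, this.2]
    beta_reduce
    rw [heq, hpy]
    nlinarith [mul_le_mul_of_nonneg_right hr (sq_nonneg ‖gramSchmidt ℝ b p‖)]

lemma sr_succMin_mono {n : ℕ} (L : AddSubgroup (EuclideanSpace ℝ (Fin n)))
    (v : Fin n → EuclideanSpace ℝ (Fin n)) (hv : LinearIndependent ℝ v) (hL : ∀ i, v i ∈ L)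
    (i j : ℕ) (hij : i ≤ j) (hj : j ≤ n) : succMin L i ≤ succMin L j := by
  unfold succMin
  apply csInf_le_csInf
  · exact ⟨0, fun r hr => hr.1⟩
  · refine ⟨∑ k, ‖v k‖, Finset.sum_nonneg fun _ _ => norm_nonneg _,
      fun k => v (Fin.castLE hj k), fun k => hL _,
      hv.comp _ (Fin.castLE_injective hj), fun k => ?_⟩
    exact Finset.single_le_sum (f := fun k => ‖v k‖) (fun _ _ => norm_nonneg _)
      (Finset.mem_univ _)
  · rintro r ⟨hr, w, h1, h2, h3⟩
    exact ⟨hr, fun k => w (Fin.castLE hij k), fun k => h1 _,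
      h2.comp _ (Fin.castLE_injective hij), fun k => h3 _⟩

lemma sr_split {n : ℕ} (b : Fin n → EuclideanSpace ℝ (Fin n)) (i : Fin n) (x : Fin n → ℤ)
    (hx : ∀ j, i < j → x j = 0) :
    ∑ j, x j • b j = x i • b i + ∑ j ∈ Finset.univ.filter (· < i), x j • b j := by
  have hnot : i ∉ Finset.univ.filter (· < i) := by simp
  rw [← Finset.sum_insert (f := fun j => x j • b j) hnot]
  symm
  apply Finset.sum_subset (Finset.subset_univ _)
  intro j _ hj
  have : i < j := by
    simp only [Finset.mem_insert, Finset.mem_filter, Finset.mem_univ, true_and, not_or] at hj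
    exact lt_of_le_of_ne (not_lt.mp hj.2) (Ne.symm hj.1)
  rw [hx j this, zero_smul]

open InnerProductSpace in
lemma sr_gs_bound {n : ℕ} (b : Fin n → EuclideanSpace ℝ (Fin n)) (i : Fin n) (x : Fin n → ℤ)
    (hx : ∀ j, i < j → x j = 0) :
    (x i : ℝ) ^ 2 * ‖gramSchmidt ℝ b i‖ ^ 2 ≤ ‖∑ j, x j • b j‖ ^ 2 := by
  rw [sr_split b i x hx]
  have hs : ∑ j ∈ Finset.univ.filter (· < i), x j • b j ∈
      Submodule.span ℝ (b '' Set.Iio i) := by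
    refine Submodule.sum_mem _ fun j hj => ?_
    rw [← Int.cast_smul_eq_zsmul ℝ]
    exact Submodule.smul_mem _ _ (Submodule.subset_span ⟨j, by simpa using hj, rfl⟩)
  have hmem := Submodule.add_mem _ (Submodule.smul_mem _ (x i : ℝ) (sr_sub_mem b i)) hs
  have hpy := sr_pyth b i _ hmem (x i : ℝ)
  have heq : x i • b i + ∑ j ∈ Finset.univ.filter (· < i), x j • b j =
      (x i : ℝ) • gramSchmidt ℝ b i + ((x i : ℝ) • (b i - gramSchmidt ℝ b i) +
        ∑ j ∈ Finset.univ.filter (· < i), x j • b j) := by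
    rw [← Int.cast_smul_eq_zsmul ℝ]
    module
  rw [heq, hpy]
  nlinarith [sq_nonneg ‖(x i : ℝ) • (b i - gramSchmidt ℝ b i) +
        ∑ j ∈ Finset.univ.filter (· < i), x j • b j‖]

lemma sr_unit {n : ℕ} (b : Fin n → EuclideanSpace ℝ (Fin n))
    (i : Fin n) (h2 : ∀ c : Fin n → ℤ,
      ‖b i‖ ≤ ‖b i + ∑ j ∈ Finset.univ.filter (· < i), c j • b j‖) (x : Fin n → ℤ)
    (hx : ∀ j, i < j → x j = 0) (h0 : x i ≠ 0) (hlt : ‖∑ j, x j • b j‖ < ‖b i‖) :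
    (4 : ℝ) ≤ (x i : ℝ) ^ 2 := by
  rw [sr_split b i x hx] at hlt
  have h : (4 : ℤ) ≤ (x i) ^ 2 := by
    by_contra hcon
    have hcases : x i = 1 ∨ x i = -1 := by
      have h1 : x i < 2 := by nlinarith
      have h3 : -2 < x i := by nlinarith
      omega
    rcases hcases with h | h
    · rw [h, one_smul] at hlt
      exact absurd (h2 x) (not_le.mpr hlt)
    · have := h2 (fun j => - x j)
      rw [h, ← norm_neg] at hlt
      simp only [neg_smul, one_smul, neg_add_rev, neg_neg, Finset.sum_neg_distrib] at hlt this
      rw [add_comm] at hlt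
      exact absurd this (not_le.mpr hlt)
  exact_mod_cast h

theorem stronglyReduced_norm_le {n : ℕ} (b : Fin n → EuclideanSpace ℝ (Fin n))
    (hli : LinearIndependent ℝ b) (hsr : StronglyReduced b) (i : Fin n) :
    ‖b i‖ ^ 2 ≤
      max 1 (((((i : ℕ) + 1 : ℝ) -
          ((Finset.univ.filter (fun j : Fin n =>
            j < i ∧ succMin (latticeOf b) ((j : ℕ) + 1) < ‖b j‖)).card : ℝ)) / 4) +
          ((Finset.univ.filter (fun j : Fin n =>
            j < i ∧ succMin (latticeOf b) ((j : ℕ) + 1) < ‖b j‖)).card : ℝ) / 16) *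
        succMin (latticeOf b) ((i : ℕ) + 1) ^ 2 := by

  obtain ⟨⟨v, x, hv, hvL, hvn, hvx, hx0, hxu⟩, h2⟩ := hsr
  set L := latticeOf b with hL
  have hn0 : ∀ j : Fin n, 0 ≤ succMin L ((j : ℕ) + 1) := fun j => hvn j ▸ norm_nonneg _
  by_cases hi : ‖b i‖ ≤ succMin L ((i : ℕ) + 1)
  · have h1 : ‖b i‖ ^ 2 ≤ 1 * succMin L ((i : ℕ) + 1) ^ 2 := by
      rw [one_mul]
      exact pow_le_pow_left₀ (norm_nonneg _) hi 2
    exact h1.trans (mul_le_mul_of_nonneg_right (le_max_left _ _) (sq_nonneg _))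
  · push Not at hi
    refine le_trans ?_ (mul_le_mul_of_nonneg_right (le_max_right _ _) (sq_nonneg _))
    set G := InnerProductSpace.gramSchmidt ℝ b with hG
    have hb1 : ∀ j, ‖G j‖ ^ 2 ≤ succMin L ((j : ℕ) + 1) ^ 2 := by
      intro j
      have := sr_gs_bound b j (x j) (hxu j)
      rw [← hvx, hvn] at this
      have h1 : (1 : ℝ) ≤ (x j j : ℝ) ^ 2 := by
        have : 0 < (x j j) ^ 2 := by have := hx0 j; positivity
        exact_mod_cast this
      nlinarith [mul_le_mul_of_nonneg_right h1 (sq_nonneg ‖G j‖)]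
    have hb2 : ∀ j : Fin n, succMin L ((j : ℕ) + 1) < ‖b j‖ →
        ‖G j‖ ^ 2 ≤ succMin L ((j : ℕ) + 1) ^ 2 / 4 := by
      intro j hj
      have := sr_gs_bound b j (x j) (hxu j)
      rw [← hvx, hvn] at this
      have h1 := sr_unit b j (h2 j) (x j) (hxu j) (hx0 j) (by rw [← hvx, hvn]; exact hj)
      nlinarith [mul_le_mul_of_nonneg_right h1 (sq_nonneg ‖G j‖)]
    have hmono : ∀ j, j < i → succMin L ((j : ℕ) + 1) ^ 2 ≤ succMin L ((i : ℕ) + 1) ^ 2 := by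
      intro j hj
      exact pow_le_pow_left₀ (hn0 j)
        (sr_succMin_mono L v hv hvL _ _ (by have := Fin.lt_def.mp hj; omega) i.2) 2
    set l := succMin L ((i : ℕ) + 1) ^ 2 with hl
    have hmem := sr_sub_mem b i
    have hset : {j : Fin n | (j : ℕ) < (i : ℕ)} = Set.Iio i := sr_set_eq _ i.2
    rw [← hset] at hmem
    obtain ⟨c, hc⟩ := sr_babai b i i.2.le _ hmem
    have hfil : Finset.univ.filter (fun j : Fin n => (j : ℕ) < (i : ℕ)) =
        Finset.univ.filter (· < i) := rfl
    rw [hfil] at hc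
    have hs : ∑ j ∈ Finset.univ.filter (· < i), c j • b j ∈
        Submodule.span ℝ (b '' {j : Fin n | (j : ℕ) < (i : ℕ)}) := by
      refine Submodule.sum_mem _ fun j hj => ?_
      rw [← Int.cast_smul_eq_zsmul ℝ]
      exact Submodule.smul_mem _ _ (Submodule.subset_span ⟨j, by simpa using hj, rfl⟩)
    have hmem2 := Submodule.add_mem _ hmem hs
    rw [hset] at hmem2
    have hpy := sr_pyth b i _ hmem2 1
    have heq : (1 : ℝ) • InnerProductSpace.gramSchmidt ℝ b i +
        (b i - InnerProductSpace.gramSchmidt ℝ b i +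
          ∑ j ∈ Finset.univ.filter (· < i), c j • b j) =
        b i + ∑ j ∈ Finset.univ.filter (· < i), c j • b j := by module
    rw [heq] at hpy
    have hle := pow_le_pow_left₀ (norm_nonneg _) (h2 i c) 2
    have hsum : ∑ j ∈ Finset.univ.filter (· < i), ‖G j‖ ^ 2 / 4 ≤
        ∑ j ∈ Finset.univ.filter (· < i),
          (l / 4 - if succMin L ((j : ℕ) + 1) < ‖b j‖ then l * (3 / 16) else 0) := by
      refine Finset.sum_le_sum fun j hj => ?_
      have hj' : j < i := by simpa using hj
      have := hmono j hj'
      split_ifs with h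
      · have := hb2 j h
        linarith
      · have := hb1 j
        linarith
    rw [Finset.sum_sub_distrib, ← Finset.sum_filter, Finset.filter_filter, Finset.sum_const,
      Finset.sum_const] at hsum
    have hcard : (Finset.univ.filter (· < i)).card = (i : ℕ) := by
      rw [Finset.filter_gt_eq_Iio, Fin.card_Iio]
    rw [hcard, nsmul_eq_mul, nsmul_eq_mul] at hsum
    have hGi := hb2 i hi
    nlinarith [hsum, hGi, hc, hle, hpy]
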